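/- Let w_1, …, w_m > 0 (m ≥ 2) and C > 0 with Σ_i exp(−C·w_i) = 1, let w_min = min_i w_i, and set p*_i = exp(−C·w_i). For each k ≥ 1, with additive block weights w^{(k)} and product PMF p^{(k)*} as above, there exists a dyadic PMF p^{(k)} on the m^k blocks whose block information rate satisfies H(p^{(k)})/(Σ_I p^{(k)}_I w^{(k)}_I) ≥ C − (log 2)/(k·w_min); hence the achievable block information rate with dyadic PMFs tends to the capacity C as k → ∞. -/

import Mathlib

/-- A probability mass function on a finite alphabet: nonnegative entries summing to 1. -/
def IsPMF {α : Type*} [Fintype α] (p : α → ℝ) : Prop :=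
  (∀ i, 0 ≤ p i) ∧ ∑ i, p i = 1

/-- A PMF is dyadic if every entry is 0 or of the form 2^(-ℓ) for a natural number ℓ. -/
def IsDyadic {α : Type*} [Fintype α] (p : α → ℝ) : Prop :=
  ∀ i, p i = 0 ∨ ∃ ℓ : ℕ, p i = (2 : ℝ) ^ (-(ℓ : ℤ))

/-- Block information rate of a PMF `p` on blocks of `k` symbols of a DNC with
weights `w`: `H(p)/(Σ_I p_I·(w_{I_1} + ⋯ + w_{I_k}))`. -/
noncomputable def blockRate {m : ℕ} (w : Fin m → ℝ) (k : ℕ)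
    (p : (Fin k → Fin m) → ℝ) : ℝ :=
  (-∑ I : Fin k → Fin m, p I * Real.log (p I)) /
    ∑ I : Fin k → Fin m, p I * ∑ t, w (I t)

/-- A finite sum of powers `2^(-ℓ)` that is at least 1 has a subsum equal to 1. -/
theorem exists_subset_sum_half_pow_eq_one {α : Type*} (ℓ : α → ℕ) (S : Finset α)
    (hS : 1 ≤ ∑ i ∈ S, (1 / 2 : ℝ) ^ ℓ i) :
    ∃ T ⊆ S, ∑ i ∈ T, (1 / 2 : ℝ) ^ ℓ i = 1 := by
  classical
  induction S using Finset.strongInduction with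
  | H S ih =>
    have hne : S.Nonempty := by
      rw [Finset.nonempty_iff_ne_empty]
      rintro rfl
      norm_num at hS
    obtain ⟨j, hj, hmax⟩ := S.exists_max_image ℓ hne
    by_cases h : 1 ≤ ∑ i ∈ S.erase j, (1 / 2 : ℝ) ^ ℓ i
    · obtain ⟨T, hT, h1⟩ := ih _ (Finset.erase_ssubset hj) h
      exact ⟨T, hT.trans (Finset.erase_subset _ _), h1⟩
    · refine ⟨S, subset_rfl, ?_⟩
      push Not at h
      have hsplit := Finset.add_sum_erase S (fun i => (1 / 2 : ℝ) ^ ℓ i) hj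
      have hscale : ((∑ i ∈ S, 2 ^ (ℓ j - ℓ i) : ℕ) : ℝ) =
          2 ^ ℓ j * ∑ i ∈ S, (1 / 2 : ℝ) ^ ℓ i := by
        push_cast
        rw [Finset.mul_sum]
        refine Finset.sum_congr rfl fun i hi => ?_
        rw [pow_sub₀ _ two_ne_zero (hmax i hi), one_div, inv_pow]
      have hpos : (0 : ℝ) < 2 ^ ℓ j := by positivity
      have hcancel : (2 : ℝ) ^ ℓ j * (1 / 2) ^ ℓ j = 1 := by
        rw [← mul_pow]; norm_num
      have hlt : ((∑ i ∈ S, 2 ^ (ℓ j - ℓ i) : ℕ) : ℝ) < ((2 ^ ℓ j + 1 : ℕ) : ℝ) := by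
        rw [hscale, ← hsplit]
        push_cast
        nlinarith
      have hle : (∑ i ∈ S, 2 ^ (ℓ j - ℓ i) : ℕ) ≤ 2 ^ ℓ j :=
        Nat.lt_succ_iff.mp (by exact_mod_cast hlt)
      have hle' : ((∑ i ∈ S, 2 ^ (ℓ j - ℓ i) : ℕ) : ℝ) ≤ 2 ^ ℓ j := by exact_mod_cast hle
      rw [hscale] at hle'
      exact le_antisymm (by nlinarith) hS

/-- Every strictly positive PMF dominates half of some dyadic PMF. -/
theorem exists_isDyadic_le_two_mul {α : Type*} [Fintype α] (q : α → ℝ)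
    (hq : ∀ i, 0 < q i) (hsum : ∑ i, q i = 1) :
    ∃ p : α → ℝ, IsPMF p ∧ IsDyadic p ∧ ∀ i, p i ≤ 2 * q i := by
  classical
  have hq1 (i : α) : q i ≤ 1 :=
    hsum ▸ Finset.single_le_sum (fun j _ => (hq j).le) (Finset.mem_univ i)
  choose ℓ hlt hle using fun i => exists_nat_pow_near_of_lt_one (hq i) (hq1 i)
    (show (0 : ℝ) < 1 / 2 by norm_num) (by norm_num)
  obtain ⟨T, -, hT⟩ := exists_subset_sum_half_pow_eq_one ℓ Finset.univ
    (hsum.symm.le.trans (Finset.sum_le_sum fun i _ => hle i))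
  refine ⟨fun i => if i ∈ T then (1 / 2) ^ ℓ i else 0, ⟨fun i => ?_, ?_⟩, fun i => ?_, fun i => ?_⟩
  · dsimp only
    split_ifs <;> positivity
  · simpa using hT
  · by_cases hi : i ∈ T
    · exact Or.inr ⟨ℓ i, by simp [hi]⟩
    · exact Or.inl (by simp [hi])
  · have h := hlt i
    rw [pow_succ] at h
    have h0 := hq i
    dsimp only
    split_ifs <;> linarith

/-- If `p ≤ 2 * q` for PMFs `p` and `q`, the relative entropy of `p` with respect to `q`
lies between `0` and `log 2`. -/
theorem relative_entropy_mem_Icc {α : Type*} [Fintype α] (p q : α → ℝ)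
    (hp : IsPMF p) (hq : ∀ i, 0 < q i) (hsum : ∑ i, q i = 1) (hpq : ∀ i, p i ≤ 2 * q i) :
    ∑ i, p i * (Real.log (p i) - Real.log (q i)) ∈ Set.Icc 0 (Real.log 2) := by
  constructor
  · have h (i : α) : p i - q i ≤ p i * (Real.log (p i) - Real.log (q i)) := by
      rcases (hp.1 i).eq_or_lt with h0 | h0
      · simp [← h0, (hq i).le]
      · have hlog := Real.log_le_sub_one_of_pos (div_pos (hq i) h0)
        rw [Real.log_div (hq i).ne' h0.ne'] at hlog
        have hmul := mul_le_mul_of_nonneg_left hlog h0.le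
        have hcancel : p i * (q i / p i - 1) = q i - p i := by field_simp
        linarith
    calc (0 : ℝ) = ∑ i, (p i - q i) := by rw [Finset.sum_sub_distrib, hp.2, hsum, sub_self]
      _ ≤ _ := Finset.sum_le_sum fun i _ => h i
  · have h (i : α) : p i * (Real.log (p i) - Real.log (q i)) ≤ p i * Real.log 2 := by
      rcases (hp.1 i).eq_or_lt with h0 | h0
      · simp [← h0]
      · refine mul_le_mul_of_nonneg_left ?_ h0.le
        have hlog := Real.log_le_log h0 (hpq i)
        rw [Real.log_mul two_ne_zero (hq i).ne'] at hlog
        linarith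
    calc _ ≤ ∑ i, p i * Real.log 2 := Finset.sum_le_sum fun i _ => h i
      _ = Real.log 2 := by rw [← Finset.sum_mul, hp.2, one_mul]

/-- A block PMF bounded by twice the capacity achieving block PMF has rate between
`C - log 2 / (k * wmin)` and `C`. -/
theorem blockRate_mem_Icc {m k : ℕ} {w : Fin m → ℝ} {C wmin : ℝ}
    (hCs : ∑ i, Real.exp (-(C * w i)) = 1) (hwmin : ∀ i, wmin ≤ w i) (hpos : 0 < wmin)
    (hk : 0 < k) (p : (Fin k → Fin m) → ℝ) (hp : IsPMF p)
    (hpq : ∀ I, p I ≤ 2 * ∏ t, Real.exp (-(C * w (I t)))) :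
    blockRate w k p ∈ Set.Icc (C - Real.log 2 / (k * wmin)) C := by
  have hsum : ∑ I : Fin k → Fin m, ∏ t, Real.exp (-(C * w (I t))) = 1 := by
    rw [← Fintype.sum_pow (fun i => Real.exp (-(C * w i))), hCs, one_pow]
  obtain ⟨hD0, hD2⟩ := relative_entropy_mem_Icc p _ hp
    (fun I => Finset.prod_pos fun t _ => Real.exp_pos _) hsum hpq
  have hlog (I : Fin k → Fin m) :
      Real.log (∏ t, Real.exp (-(C * w (I t)))) = -(C * ∑ t, w (I t)) := by
    rw [← Real.exp_sum, Real.log_exp, Finset.sum_neg_distrib, Finset.mul_sum]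
  simp only [hlog] at hD0 hD2
  set D := ∑ I, p I * (Real.log (p I) - -(C * ∑ t, w (I t))) with hD
  set W := ∑ I, p I * ∑ t, w (I t) with hW
  have hDW : -∑ I, p I * Real.log (p I) = C * W - D := by
    rw [hD, hW, Finset.mul_sum, ← Finset.sum_sub_distrib, ← Finset.sum_neg_distrib]
    exact Finset.sum_congr rfl fun I _ => by ring
  have hkw : 0 < k * wmin := by positivity
  have hwI (I : Fin k → Fin m) : k * wmin ≤ ∑ t, w (I t) := by
    simpa using Finset.card_nsmul_le_sum Finset.univ (fun t => w (I t)) wmin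
      (fun t _ => hwmin (I t))
  have hWk : k * wmin ≤ W := by
    calc (k : ℝ) * wmin = ∑ I, p I * (k * wmin) := by rw [← Finset.sum_mul, hp.2, one_mul]
      _ ≤ W := Finset.sum_le_sum fun I _ => mul_le_mul_of_nonneg_left (hwI I) (hp.1 I)
  have hW0 : 0 < W := hkw.trans_le hWk
  have hrate : blockRate w k p = C - D / W := by
    rw [blockRate, hDW, ← hW, sub_div, mul_div_cancel_right₀ _ hW0.ne']
  have hdiv : D / W ≤ Real.log 2 / (k * wmin) := div_le_div₀ (by positivity) hD2 hkw hWk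
  have hdiv0 : 0 ≤ D / W := div_nonneg hD0 hW0.le
  rw [hrate]
  constructor <;> linarith


/-- For a DNC with weights `w_i > 0` (`m ≥ 2`), capacity `C > 0`
(`Σ_i exp(−C·w_i) = 1`) and minimal weight `w_min`: for every `k ≥ 1` there is a
dyadic PMF on the `m^k` blocks with block information rate at least
`C − (log 2)/(k·w_min)`; hence the achievable dyadic block rate tends to `C`. -/
theorem dnc_dyadic_block_pmf_achieves_capacity (m : ℕ) (hm : 2 ≤ m)
    (w : Fin m → ℝ) (hw : ∀ i, 0 < w i)
    (C : ℝ) (hC : 0 < C) (hCs : ∑ i, Real.exp (-(C * w i)) = 1)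
    (wmin : ℝ) (hwmin : IsLeast (Set.range w) wmin) :
    ∃ P : (k : ℕ) → ((Fin k → Fin m) → ℝ),
      (∀ k : ℕ, 0 < k → IsPMF (P k) ∧ IsDyadic (P k) ∧
        blockRate w k (P k) ≥ C - Real.log 2 / (k * wmin)) ∧
      Filter.Tendsto (fun k : ℕ => blockRate w k (P k))
        Filter.atTop (nhds C) := by
  have hpos : 0 < wmin := by
    obtain ⟨i, hi⟩ := hwmin.1
    exact hi ▸ hw i
  choose P hP hdyadic hPq using fun k : ℕ => exists_isDyadic_le_two_mul
    (fun I : Fin k → Fin m => ∏ t, Real.exp (-(C * w (I t))))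
    (fun I => Finset.prod_pos fun t _ => Real.exp_pos _)
    (by rw [← Fintype.sum_pow (fun i => Real.exp (-(C * w i))), hCs, one_pow])
  have hrate (k : ℕ) (hk : 0 < k) := blockRate_mem_Icc hCs
    (fun i => hwmin.2 (Set.mem_range_self i)) hpos hk (P k) (hP k) (hPq k)
  refine ⟨P, fun k hk => ⟨hP k, hdyadic k, (hrate k hk).1⟩, ?_⟩
  have hlim : Filter.Tendsto (fun k : ℕ => C - Real.log 2 / (k * wmin))
      Filter.atTop (nhds C) := by
    simpa using tendsto_const_nhds.sub (Filter.Tendsto.const_div_atTop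
      (tendsto_natCast_atTop_atTop.atTop_mul_const hpos) (Real.log 2))
  refine tendsto_of_tendsto_of_tendsto_of_le_of_le' hlim tendsto_const_nhds ?_ ?_
  · filter_upwards [Filter.eventually_gt_atTop 0] with k hk using (hrate k hk).1
  · filter_upwards [Filter.eventually_gt_atTop 0] with k hk using (hrate k hk).2
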